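/- The graph G(μ) is connected. -/

import Mathlib

open Finset

/-- The open counterclockwise arc `{v+1, …, v+(k-1)}` (indexed by `i = 1,…,k-1`) is
balanced: it contains as many elements where `μ = 1` as elements where `μ = -1`. -/
def ArcBalanced (n : ℕ) (μ : ZMod (2*n+1) → ℤ) (v : ZMod (2*n+1)) (k : ℕ) : Prop :=
  ((Finset.Icc 1 (k-1)).filter fun i : ℕ => μ (v + (i : ZMod (2*n+1))) = 1).card =
  ((Finset.Icc 1 (k-1)).filter fun i : ℕ => μ (v + (i : ZMod (2*n+1))) = -1).card

/-- `k` is a valid cancellation length for an `A`-band at `v`: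
`μ (v+k) = 1` and the open arc `{v+1, …, v+(k-1)}` is balanced. -/
def AGood (n : ℕ) (μ : ZMod (2*n+1) → ℤ) (v : ZMod (2*n+1)) (k : ℕ) : Prop :=
  μ (v + (k : ZMod (2*n+1))) = 1 ∧ ArcBalanced n μ v k

/-- `k` is a valid cancellation length for a `B`-band at `v`:
`μ (v-k) = 1` and the open arc `{v-k+1, …, v-1}` is balanced. -/
def BGood (n : ℕ) (μ : ZMod (2*n+1) → ℤ) (v : ZMod (2*n+1)) (k : ℕ) : Prop :=
  μ (v - (k : ZMod (2*n+1))) = 1 ∧ ArcBalanced n μ (v - (k : ZMod (2*n+1))) k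

/-- `w` is the `A`-partner of `v`: `w = v + k` for the least `k ∈ {1,…,2n}` with
`μ (v+k) = 1` and the open arc `{v+1,…,v+(k-1)}` balanced. -/
def IsAPartner (n : ℕ) (μ : ZMod (2*n+1) → ℤ) (v w : ZMod (2*n+1)) : Prop :=
  ∃ k ∈ Finset.Icc 1 (2*n), AGood n μ v k ∧
    (∀ j ∈ Finset.Icc 1 (2*n), j < k → ¬ AGood n μ v j) ∧ w = v + (k : ZMod (2*n+1))

/-- `w` is the `B`-partner of `v`: `w = v - k` for the least `k ∈ {1,…,2n}` with
`μ (v-k) = 1` and the open arc `{v-k+1,…,v-1}` balanced. -/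
def IsBPartner (n : ℕ) (μ : ZMod (2*n+1) → ℤ) (v w : ZMod (2*n+1)) : Prop :=
  ∃ k ∈ Finset.Icc 1 (2*n), BGood n μ v k ∧
    (∀ j ∈ Finset.Icc 1 (2*n), j < k → ¬ BGood n μ v j) ∧ w = v - (k : ZMod (2*n+1))

/-- The auxiliary graph `G(μ)`: its edges are exactly the unordered pairs
`{v, A-partner of v}` and `{v, B-partner of v}` over all `v` with `μ v = -1`. -/
def G (n : ℕ) (μ : ZMod (2*n+1) → ℤ) : SimpleGraph (ZMod (2*n+1)) :=
  SimpleGraph.fromRel fun x y => μ x = -1 ∧ (IsAPartner n μ x y ∨ IsBPartner n μ x y)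

noncomputable instance {n : ℕ} {μ : ZMod (2*n+1) → ℤ} {v : ZMod (2*n+1)} :
    Fintype ((G n μ).neighborSet v) := Fintype.ofFinite _

/-- The number of `+1`s minus the number of `-1`s among the residues of `0, …, m - 1`. -/
def height (n : ℕ) (μ : ZMod (2*n+1) → ℤ) (m : ℕ) : ℤ :=
  ∑ i ∈ range m, μ (i : ZMod (2*n+1))

/-- The lower end of the step that `height` takes from `m` to `m + 1`. -/
def level (n : ℕ) (μ : ZMod (2*n+1) → ℤ) (m : ℕ) : ℤ :=
  min (height n μ m) (height n μ (m + 1))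

section

variable {n : ℕ} {μ : ZMod (2*n+1) → ℤ}

lemma height_succ (m : ℕ) : height n μ (m + 1) = height n μ m + μ (m : ZMod (2*n+1)) :=
  sum_range_succ _ _

lemma sum_eq_card_sub_card {ι : Type*} (s : Finset ι) (f : ι → ℤ)
    (hf : ∀ i, f i = 1 ∨ f i = -1) :
    ∑ i ∈ s, f i = ((s.filter fun i => f i = 1).card : ℤ) - (s.filter fun i => f i = -1).card := by
  rw [card_filter, card_filter]
  push_cast
  rw [← sum_sub_distrib]
  refine sum_congr rfl fun i _ => ?_
  rcases hf i with h | h <;> simp [h]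

lemma arcBalanced_iff (hval : ∀ v, μ v = 1 ∨ μ v = -1) (i k : ℕ) (hk : 1 ≤ k) :
    ArcBalanced n μ (i : ZMod (2*n+1)) k ↔ height n μ (i + k) = height n μ (i + 1) := by
  obtain ⟨d, rfl⟩ := Nat.exists_eq_add_of_le hk
  have hsum : ∀ d : ℕ, height n μ (i + (1 + d)) = height n μ (i + 1)
      + ∑ t ∈ Icc 1 d, μ ((i : ZMod (2*n+1)) + (t : ZMod (2*n+1))) := by
    intro d
    induction d with
    | zero => simp
    | succ d ih =>
      rw [sum_Icc_succ_top (by omega), show i + (1 + (d + 1)) = (i + (1 + d)) + 1 by ring,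
        height_succ, ih]
      push_cast
      ring_nf
  rw [hsum, sum_eq_card_sub_card _ _ (fun _ => hval _), ArcBalanced, Nat.add_sub_cancel_left]
  omega

lemma height_add_period (hval : ∀ v, μ v = 1 ∨ μ v = -1)
    (hplus : (univ.filter fun v : ZMod (2*n+1) => μ v = 1).card = n + 1)
    (hminus : (univ.filter fun v : ZMod (2*n+1) => μ v = -1).card = n) (m : ℕ) :
    height n μ (m + (2*n+1)) = height n μ m + 1 := by
  induction m with
  | zero =>
    have h := sum_eq_card_sub_card univ μ hval
    have hrange : ∑ v, μ v = ∑ i ∈ range (2*n+1), μ (i : ZMod (2*n+1)) := by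
      rw [← Fin.sum_univ_eq_sum_range (fun i : ℕ => μ (i : ZMod (2*n+1)))]
      exact sum_congr rfl fun v _ => congrArg μ (ZMod.natCast_zmod_val v).symm
    rw [hplus, hminus, hrange] at h
    simp only [height, zero_add, h, range_zero, sum_empty]
    push_cast
    ring
  | succ m ih =>
    have hcast : ((m + (2*n+1) : ℕ) : ZMod (2*n+1)) = m := by
      rw [Nat.cast_add, ZMod.natCast_self, add_zero]
    rw [show m + 1 + (2*n+1) = m + (2*n+1) + 1 by ring, height_succ, height_succ, ih, hcast]
    ring

lemma exists_up_step (hval : ∀ v, μ v = 1 ∨ μ v = -1) {p q : ℕ} {a : ℤ} (hpq : p ≤ q)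
    (hp : height n μ p ≤ a) (hq : a < height n μ q) :
    ∃ m, p ≤ m ∧ m < q ∧ μ (m : ZMod (2*n+1)) = 1 ∧ height n μ m = a := by
  induction q, hpq using Nat.le_induction with
  | base => omega
  | succ q hpq ih =>
    have hs := height_succ (μ := μ) q
    by_cases h : a < height n μ q
    · obtain ⟨m, h₁, h₂, h₃⟩ := ih h
      exact ⟨m, h₁, by omega, h₃⟩
    · rcases hval (q : ZMod (2*n+1)) with h' | h'
      · exact ⟨q, hpq, by omega, h', by omega⟩
      · omega

lemma exists_down_step (hval : ∀ v, μ v = 1 ∨ μ v = -1) {p q : ℕ} {a : ℤ} (hpq : p ≤ q)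
    (hp : a ≤ height n μ p) (hq : height n μ q < a) :
    ∃ m, p ≤ m ∧ m < q ∧ μ (m : ZMod (2*n+1)) = -1 ∧ height n μ m = a := by
  induction q, hpq using Nat.le_induction with
  | base => omega
  | succ q hpq ih =>
    have hs := height_succ (μ := μ) q
    by_cases h : height n μ q < a
    · obtain ⟨m, h₁, h₂, h₃⟩ := ih h
      exact ⟨m, h₁, by omega, h₃⟩
    · rcases hval (q : ZMod (2*n+1)) with h' | h'
      · omega
      · exact ⟨q, hpq, by omega, h', by omega⟩

lemma exists_least_mem_Icc (P : ℕ → Prop) {N k : ℕ} (hk : k ∈ Icc 1 N) (hP : P k) :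
    ∃ m ∈ Icc 1 N, m ≤ k ∧ P m ∧ ∀ j ∈ Icc 1 N, j < m → ¬ P j := by
  classical
  have hex : ∃ m, m ∈ Icc 1 N ∧ P m := ⟨k, hk, hP⟩
  exact ⟨Nat.find hex, (Nat.find_spec hex).1, Nat.find_min' hex ⟨hk, hP⟩, (Nat.find_spec hex).2,
    fun j hj hlt hPj => Nat.find_min hex hlt ⟨hj, hPj⟩⟩

lemma G_adj_of_partner {v w : ZMod (2*n+1)} (hv : μ v = -1) (hw : μ w = 1)
    (h : IsAPartner n μ v w ∨ IsBPartner n μ v w) : (G n μ).Adj v w := by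
  refine (SimpleGraph.fromRel_adj _ _ _).2 ⟨?_, Or.inl ⟨hv, h⟩⟩
  rintro rfl
  omega

/-- The up-step following a down-step at the same level is joined to it. -/
lemma exists_adj_up_step_after (hval : ∀ v, μ v = 1 ∨ μ v = -1)
    (hper : ∀ m, height n μ (m + (2*n+1)) = height n μ m + 1) {i j : ℕ} (hij : i < j)
    (hi : μ (i : ZMod (2*n+1)) = -1) (hj : μ (j : ZMod (2*n+1)) = 1)
    (hlev : height n μ j = height n μ (i + 1)) :
    ∃ m, i < m ∧ m ≤ j ∧ μ (m : ZMod (2*n+1)) = 1 ∧ height n μ m = height n μ (i + 1) ∧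
      (G n μ).Adj (i : ZMod (2*n+1)) (m : ZMod (2*n+1)) := by
  obtain ⟨m, him, hmj, hmi, hm, hml⟩ : ∃ m, i < m ∧ m ≤ j ∧ m ≤ i + 2*n ∧
      μ (m : ZMod (2*n+1)) = 1 ∧ height n μ m = height n μ (i + 1) := by
    by_cases h : j ≤ i + 2*n
    · exact ⟨j, hij, le_rfl, h, hj, hlev⟩
    · have hs := height_succ (μ := μ) i
      have hp := hper i
      obtain ⟨m, h₁, h₂, h₃, h₄⟩ := exists_up_step hval (p := i + 1) (q := i + (2*n+1))
        (by omega) le_rfl (by omega)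
      exact ⟨m, by omega, by omega, by omega, h₃, h₄⟩
  obtain ⟨k, hk, hkm, hgood, hmin⟩ := exists_least_mem_Icc (AGood n μ (i : ZMod (2*n+1)))
    (N := 2*n) (k := m - i) (mem_Icc.2 (by omega))
    (by
      rw [AGood, arcBalanced_iff hval _ _ (by omega), ← Nat.cast_add, Nat.add_sub_cancel' him.le]
      exact ⟨hm, hml⟩)
  have hk' := mem_Icc.1 hk
  have hgood' := hgood
  rw [AGood, arcBalanced_iff hval _ _ hk'.1, ← Nat.cast_add] at hgood'
  exact ⟨i + k, by omega, by omega, hgood'.1, hgood'.2,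
    G_adj_of_partner hi hgood'.1 (Or.inl ⟨k, hk, hgood, hmin, by push_cast; rfl⟩)⟩

/-- The up-step preceding a down-step at the same level is joined to it. -/
lemma exists_adj_up_step_before (hval : ∀ v, μ v = 1 ∨ μ v = -1)
    (hper : ∀ m, height n μ (m + (2*n+1)) = height n μ m + 1) {i j : ℕ} (hij : i < j)
    (hi : μ (i : ZMod (2*n+1)) = 1) (hj : μ (j : ZMod (2*n+1)) = -1)
    (hlev : height n μ j = height n μ (i + 1)) :
    ∃ m, i ≤ m ∧ m < j ∧ μ (m : ZMod (2*n+1)) = 1 ∧ height n μ (m + 1) = height n μ j ∧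
      (G n μ).Adj (j : ZMod (2*n+1)) (m : ZMod (2*n+1)) := by
  have hgood_iff : ∀ k, 1 ≤ k → k ≤ j → (BGood n μ (j : ZMod (2*n+1)) k ↔
      μ ((j - k : ℕ) : ZMod (2*n+1)) = 1 ∧ height n μ j = height n μ (j - k + 1)) := by
    intro k hk hkj
    rw [BGood, ← Nat.cast_sub hkj, arcBalanced_iff hval _ _ hk, Nat.sub_add_cancel hkj]
  obtain ⟨m, him, hmj, hjm, hm, hml⟩ : ∃ m, i ≤ m ∧ m < j ∧ j ≤ m + 2*n ∧
      μ (m : ZMod (2*n+1)) = 1 ∧ height n μ (m + 1) = height n μ j := by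
    by_cases h : j ≤ i + 2*n
    · exact ⟨i, le_rfl, hij, h, hi, hlev.symm⟩
    · have hs := height_succ (μ := μ) j
      have hp := hper (j - 2*n)
      rw [show j - 2*n + (2*n+1) = j + 1 by omega] at hp
      obtain ⟨m, h₁, h₂, h₃, h₄⟩ := exists_up_step hval (p := j - 2*n) (q := j)
        (a := height n μ j - 1) (by omega) (by omega) (by omega)
      have hs' := height_succ (μ := μ) m
      exact ⟨m, by omega, by omega, by omega, h₃, by omega⟩
  obtain ⟨k, hk, hkm, hgood, hmin⟩ := exists_least_mem_Icc (BGood n μ (j : ZMod (2*n+1)))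
    (N := 2*n) (k := j - m) (mem_Icc.2 (by omega))
    (by
      rw [hgood_iff _ (by omega) (by omega), Nat.sub_sub_self hmj.le]
      exact ⟨hm, hml.symm⟩)
  have hk' := mem_Icc.1 hk
  have hgood' := (hgood_iff k hk'.1 (by omega)).1 hgood
  exact ⟨j - k, by omega, by omega, hgood'.1, hgood'.2.symm,
    G_adj_of_partner hj hgood'.1 (Or.inr ⟨k, hk, hgood, hmin, Nat.cast_sub (by omega)⟩)⟩

lemma reachable_of_level_eq_of_le (hval : ∀ v, μ v = 1 ∨ μ v = -1)
    (hper : ∀ m, height n μ (m + (2*n+1)) = height n μ m + 1) (d : ℕ) :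
    ∀ i j : ℕ, i ≤ j → j - i ≤ d → level n μ i = level n μ j →
      (G n μ).Reachable (i : ZMod (2*n+1)) (j : ZMod (2*n+1)) := by
  induction d with
  | zero =>
    intro i j hij hd _
    rw [show i = j by omega]
  | succ d ih =>
    intro i j hij hd hlev
    rcases hij.eq_or_lt with rfl | hlt
    · rfl
    have hlevel : ∀ m, level n μ m = min (height n μ m) (height n μ (m + 1)) := fun _ => rfl
    have hsi := height_succ (μ := μ) i
    have hsj := height_succ (μ := μ) j
    have hli := hlevel i
    have hlj := hlevel j
    rcases hval (i : ZMod (2*n+1)) with hi | hi <;> rcases hval (j : ZMod (2*n+1)) with hj | hj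
    · obtain ⟨m, h₁, h₂, h₃, h₄⟩ := exists_down_step hval (p := i + 1) (q := j)
        (a := height n μ (i + 1)) (by omega) le_rfl (by omega)
      have hsm := height_succ (μ := μ) m
      have hlm := hlevel m
      exact (ih i m (by omega) (by omega) (by omega)).trans
        (ih m j (by omega) (by omega) (by omega))
    · obtain ⟨m, h₁, h₂, h₃, h₄, hadj⟩ :=
        exists_adj_up_step_before hval hper hlt hi hj (by omega)
      have hsm := height_succ (μ := μ) m
      have hlm := hlevel m
      exact (ih i m (by omega) (by omega) (by omega)).trans hadj.symm.reachable
    · obtain ⟨m, h₁, h₂, h₃, h₄, hadj⟩ :=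
        exists_adj_up_step_after hval hper hlt hi hj (by omega)
      have hsm := height_succ (μ := μ) m
      have hlm := hlevel m
      exact hadj.reachable.trans (ih m j (by omega) (by omega) (by omega))
    · obtain ⟨m, h₁, h₂, h₃, h₄⟩ := exists_up_step hval (p := i + 1) (q := j)
        (a := height n μ (i + 1)) (by omega) le_rfl (by omega)
      have hsm := height_succ (μ := μ) m
      have hlm := hlevel m
      exact (ih i m (by omega) (by omega) (by omega)).trans
        (ih m j (by omega) (by omega) (by omega))

lemma reachable_of_level_eq (hval : ∀ v, μ v = 1 ∨ μ v = -1)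
    (hper : ∀ m, height n μ (m + (2*n+1)) = height n μ m + 1) {i j : ℕ}
    (h : level n μ i = level n μ j) :
    (G n μ).Reachable (i : ZMod (2*n+1)) (j : ZMod (2*n+1)) := by
  rcases le_total i j with hij | hij
  · exact reachable_of_level_eq_of_le hval hper _ i j hij le_rfl h
  · exact (reachable_of_level_eq_of_le hval hper _ j i hij le_rfl h.symm).symm

lemma level_add_mul_period (hper : ∀ m, height n μ (m + (2*n+1)) = height n μ m + 1) (m t : ℕ) :
    level n μ (m + t * (2*n+1)) = level n μ m + t := by
  induction t with
  | zero => simp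
  | succ t ih =>
    have h₁ := hper (m + t * (2*n+1))
    have h₂ := hper (m + t * (2*n+1) + 1)
    rw [show m + (t + 1) * (2*n+1) = m + t * (2*n+1) + (2*n+1) by ring]
    rw [show m + t * (2*n+1) + 1 + (2*n+1) = m + t * (2*n+1) + (2*n+1) + 1 by ring] at h₂
    rw [level] at ih ⊢
    push_cast
    omega

end

theorem connected (n : ℕ) (μ : ZMod (2*n+1) → ℤ)
    (hn : 0 < n)
    (hval : ∀ v, μ v = 1 ∨ μ v = -1)
    (hplus : (Finset.univ.filter fun v : ZMod (2*n+1) => μ v = 1).card = n + 1)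
    (hminus : (Finset.univ.filter fun v : ZMod (2*n+1) => μ v = -1).card = n) :
    (G n μ).Connected := by
  have hper := height_add_period hval hplus hminus
  have hreach : ∀ i j : ℕ, level n μ i ≤ level n μ j →
      (G n μ).Reachable (i : ZMod (2*n+1)) (j : ZMod (2*n+1)) := by
    intro i j hij
    obtain ⟨t, ht⟩ := Int.le.dest hij
    have h := reachable_of_level_eq hval hper ((level_add_mul_period hper i t).trans ht)
    rwa [Nat.cast_add, Nat.cast_mul, ZMod.natCast_self, mul_zero, add_zero] at h
  refine (SimpleGraph.connected_iff _).2 ⟨fun v w => ?_, inferInstance⟩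
  rw [← ZMod.natCast_zmod_val v, ← ZMod.natCast_zmod_val w]
  rcases le_total (level n μ v.val) (level n μ w.val) with h | h
  · exact hreach _ _ h
  · exact (hreach _ _ h).symm
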